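/- arXiv:2305.02850 — 5 statements merged into one kernel-verified Lean document; each statement's English description precedes it below -/
import Mathlib

section
/- For every integer k ≥ 3 and every function p : ℕ → ℕ, there exist sequences h_1,…,h_k and w_1,…,w_k of positive reals such that: the partition C = (C_1,…,C_k) achieves the minimum weighted k-means cost among all partitions of the 2k weighted points of X(w,h) into at most k clusters, and every partition of the 2k weighted points into at most k clusters other than C has weighted k-means cost at least p(2k) times the weighted k-means cost of C. -/
noncomputable section

attribute [local instance] Classical.propDecidable

/-- A threshold decision tree over `ℝ^d`: every internal node is labeled by a
coordinate index and a real threshold. -/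
inductive TDT (d : ℕ) : Type
  | leaf : TDT d
  | node (r : Fin d) (θ : ℝ) (left right : TDT d) : TDT d

namespace TDT

/-- The number of leaves of a threshold decision tree. -/
def leaves {d : ℕ} : TDT d → ℕ
  | leaf => 1
  | node _ _ l r => l.leaves + r.leaves

/-- The depth of a threshold decision tree: the maximum number of internal nodes
on a root-to-leaf path. -/
def depth {d : ℕ} : TDT d → ℕ
  | leaf => 0
  | node _ _ l r => max l.depth r.depth + 1

/-- The index (numbering leaves from left to right) of the leaf a point is routed to:
at a node labeled `(r, θ)` the point goes left when its `r`-th coordinate is `< θ`,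
and right otherwise. -/
def route {d : ℕ} : TDT d → EuclideanSpace ℝ (Fin d) → ℕ
  | leaf, _ => 0
  | node r θ l rt, x => if x r < θ then l.route x else l.leaves + rt.route x

/-- The clustering of a finite multiset induced by a threshold decision tree:
the partition of `X` into the nonempty fibers of `route` (points routed to the
same leaf form one cluster). -/
def clustering {d : ℕ} (t : TDT d) (X : Multiset (EuclideanSpace ℝ (Fin d))) :
    Multiset (Multiset (EuclideanSpace ℝ (Fin d))) :=
  Multiset.filter (fun C => C ≠ 0)
    ((Finset.range t.leaves).val.map fun i => X.filter fun x => t.route x = i)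

end TDT

/-- `P` is a partition of the multiset `X` into at most `k` nonempty clusters. -/
def IsClustering {d : ℕ} (X : Multiset (EuclideanSpace ℝ (Fin d))) (k : ℕ)
    (P : Multiset (Multiset (EuclideanSpace ℝ (Fin d)))) : Prop :=
  P.sum = X ∧ Multiset.card P ≤ k ∧ (0 : Multiset (EuclideanSpace ℝ (Fin d))) ∉ P

/-- The `1`-means cost of a single cluster: `inf_c Σ_{x ∈ C} ‖x - c‖²`. -/
def costMeans1 {d : ℕ} (C : Multiset (EuclideanSpace ℝ (Fin d))) : ℝ :=
  ⨅ c : EuclideanSpace ℝ (Fin d), (C.map fun x => ‖x - c‖ ^ 2).sum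

/-- The k-means cost of a partition. -/
def costMeans {d : ℕ} (P : Multiset (Multiset (EuclideanSpace ℝ (Fin d)))) : ℝ :=
  (P.map costMeans1).sum

/-- The `1`-median cost of a single cluster: `inf_c Σ_{x ∈ C} ‖x - c‖`. -/
def costMedian1 {d : ℕ} (C : Multiset (EuclideanSpace ℝ (Fin d))) : ℝ :=
  ⨅ c : EuclideanSpace ℝ (Fin d), (C.map fun x => ‖x - c‖).sum

/-- The k-median cost of a partition. -/
def costMedian {d : ℕ} (P : Multiset (Multiset (EuclideanSpace ℝ (Fin d)))) : ℝ :=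
  (P.map costMedian1).sum

/-- The `1`-center cost of a single cluster: `inf_c max_{x ∈ C} ‖x - c‖`. -/
def costCenter1 {d : ℕ} (C : Multiset (EuclideanSpace ℝ (Fin d))) : ℝ :=
  ⨅ c : EuclideanSpace ℝ (Fin d), sSup ((fun x => ‖x - c‖) '' {x | x ∈ C})

/-- The k-center cost of a partition: the maximum over clusters of the `1`-center cost. -/
def costCenter {d : ℕ} (P : Multiset (Multiset (EuclideanSpace ℝ (Fin d)))) : ℝ :=
  sSup (costCenter1 '' {C | C ∈ P})

/-- The optimal k-means cost of `X` over all partitions into at most `k` clusters. -/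
def optMeans {d : ℕ} (X : Multiset (EuclideanSpace ℝ (Fin d))) (k : ℕ) : ℝ :=
  sInf {r : ℝ | ∃ P, IsClustering X k P ∧ r = costMeans P}

/-- The optimal k-median cost of `X` over all partitions into at most `k` clusters. -/
def optMedian {d : ℕ} (X : Multiset (EuclideanSpace ℝ (Fin d))) (k : ℕ) : ℝ :=
  sInf {r : ℝ | ∃ P, IsClustering X k P ∧ r = costMedian P}

/-- The optimal k-center cost of `X` over all partitions into at most `k` clusters. -/
def optCenter {d : ℕ} (X : Multiset (EuclideanSpace ℝ (Fin d))) (k : ℕ) : ℝ :=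
  sInf {r : ℝ | ∃ P, IsClustering X k P ∧ r = costCenter P}

/-! ### The high-dimensional point-set `X(n, ε, d)` -/

/-- The sign `1` or `-1` encoded by a boolean. -/
def sgn (b : Bool) : ℝ := if b then 1 else -1

/-- The point `a·e_i + ε·b·e_j` (with signs `a, b` encoded by booleans). -/
def hdPoint (d : ℕ) (ε : ℝ) (i j : Fin d) (a b : Bool) : EuclideanSpace ℝ (Fin d) :=
  EuclideanSpace.single i (sgn a) + EuclideanSpace.single j (ε * sgn b)

/-- The ε-ball `B_i^a`: `n` copies of `a·e_i + ε·b·e_j` for all `j` and signs `b`. -/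
def epsBall (n d : ℕ) (ε : ℝ) (i : Fin d) (a : Bool) : Multiset (EuclideanSpace ℝ (Fin d)) :=
  (Finset.univ : Finset (Fin d × Bool)).val.bind fun jb =>
    Multiset.replicate n (hdPoint d ε i jb.1 a jb.2)

/-- The partition `C` of `X(n, ε, d)` into the `2d` ε-balls `B_i^a`. -/
def XhdPartition (n d : ℕ) (ε : ℝ) : Multiset (Multiset (EuclideanSpace ℝ (Fin d))) :=
  (Finset.univ : Finset (Fin d × Bool)).val.map fun ia => epsBall n d ε ia.1 ia.2

/-- The multiset `X(n, ε, d)`: `n` copies of `a·e_i + ε·b·e_j` for all `i, j ∈ [d]`,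
`a, b ∈ {1, -1}`; it has `4nd²` points counted with multiplicity. -/
def Xhd (n d : ℕ) (ε : ℝ) : Multiset (EuclideanSpace ℝ (Fin d)) :=
  (XhdPartition n d ε).sum

/-! ### The weighted planar point-set `X(w, h)` -/

/-- A pair of reals viewed as a point of the Euclidean plane. -/
def toE2 (q : ℝ × ℝ) : EuclideanSpace ℝ (Fin 2) :=
  (WithLp.equiv 2 (Fin 2 → ℝ)).symm ![q.1, q.2]

/-- `planarP h i = (p_i^1, p_i^2)`, the two points of the `i`-th cluster of the
weighted planar point-set `X(w, h)` (positions depend only on `h`). -/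
def planarP (h : ℕ → ℝ) : ℕ → (ℝ × ℝ) × (ℝ × ℝ)
  | 0 => ((0, 0), (0, 0))
  | 1 => ((0, 0), (0, 0))
  | 2 => ((h 2, 0), (h 2, 0))
  | i + 3 =>
      let q := planarP h (i + 1)
      let q' := planarP h (i + 2)
      if (i + 3) % 2 = 1 then
        ((q.1.1 - 1, q.1.2 + h (i + 3)), (q'.2.1 + 1, q.2.2 + h (i + 3)))
      else
        ((q.1.1 + h (i + 3), q.1.2 - 1), (q.2.1 + h (i + 3), q'.2.2 + 1))

/-- The position of the weighted point indexed by `(i, a) : Fin k × Fin 2`,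
i.e. `p_{i+1}^{a+1}`. -/
def wpt (k : ℕ) (h : ℕ → ℝ) (x : Fin k × Fin 2) : EuclideanSpace ℝ (Fin 2) :=
  toE2 (if x.2 = (0 : Fin 2) then (planarP h ((x.1 : ℕ) + 1)).1
        else (planarP h ((x.1 : ℕ) + 1)).2)

/-- `P` is a partition of the index set of the `2k` weighted points into at most `k`
nonempty clusters. -/
def IsIdxPartition (k : ℕ) (P : Finset (Finset (Fin k × Fin 2))) : Prop :=
  P.card ≤ k ∧ (∀ S ∈ P, S.Nonempty) ∧
    ∀ x : Fin k × Fin 2, ∃! S : Finset (Fin k × Fin 2), S ∈ P ∧ x ∈ S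

/-- The weighted k-means cost of a partition of the index set of `X(w, h)`. -/
def wCostMeans (k : ℕ) (h w : ℕ → ℝ) (P : Finset (Finset (Fin k × Fin 2))) : ℝ :=
  ∑ S ∈ P, ⨅ c : EuclideanSpace ℝ (Fin 2),
    ∑ x ∈ S, w ((x.1 : ℕ) + 1) * ‖wpt k h x - c‖ ^ 2

/-- The weighted k-median cost of a partition of the index set of `X(w, h)`. -/
def wCostMedian (k : ℕ) (h w : ℕ → ℝ) (P : Finset (Finset (Fin k × Fin 2))) : ℝ :=
  ∑ S ∈ P, ⨅ c : EuclideanSpace ℝ (Fin 2),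
    ∑ x ∈ S, w ((x.1 : ℕ) + 1) * ‖wpt k h x - c‖

/-- The minimum weighted k-means cost over all partitions of the `2k` weighted points
into at most `k` clusters. -/
def wOptMeans (k : ℕ) (h w : ℕ → ℝ) : ℝ :=
  sInf {r : ℝ | ∃ P, IsIdxPartition k P ∧ r = wCostMeans k h w P}

/-- The minimum weighted k-median cost over all partitions of the `2k` weighted points
into at most `k` clusters. -/
def wOptMedian (k : ℕ) (h w : ℕ → ℝ) : ℝ :=
  sInf {r : ℝ | ∃ P, IsIdxPartition k P ∧ r = wCostMedian k h w P}

/-- The canonical partition `C = (C_1, …, C_k)` of the index set, where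
`C_i = {p_i^1, p_i^2}`. -/
def wCanonical (k : ℕ) : Finset (Finset (Fin k × Fin 2)) :=
  (Finset.univ : Finset (Fin k)).image fun i =>
    Finset.univ.filter fun x : Fin k × Fin 2 => x.1 = i

/-- The partition of the index set of the `2k` weighted points induced by a threshold
decision tree (nonempty fibers of the routing of the corresponding positions). -/
def treeIdxPartition (k : ℕ) (t : TDT 2) (h : ℕ → ℝ) : Finset (Finset (Fin k × Fin 2)) :=
  Finset.filter (fun S => S.Nonempty)
    ((Finset.range t.leaves).image fun ℓ =>
      Finset.univ.filter fun x : Fin k × Fin 2 => t.route (wpt k h x) = ℓ)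

/-! ### The planar point-set `Y_k` for k-center -/

/-- The four points of the first cluster of `Y_k`. -/
def Ybase1 : Fin 4 → ℝ × ℝ := ![(-1, 0), (-1.5, 0.5), (-1, 1), (-0.5, 0.5)]

/-- The four points of the second cluster of `Y_k`. -/
def Ybase2 : Fin 4 → ℝ × ℝ := ![(1, 0), (0.5, 0.5), (1, 1), (1.5, 0.5)]

/-- `Ypt i a = p_i^{a+1}`, the `a`-th point of the `i`-th cluster of `Y_k`. -/
def Ypt : ℕ → Fin 4 → ℝ × ℝ
  | 0, _ => (0, 0)
  | 1, a => Ybase1 a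
  | 2, a => Ybase2 a
  | 3, a => Ybase1 a + (1, 2)
  | 4, a => Ybase2 a + (2, 1)
  | i + 5, a => Ypt (i + 3) a + (2, 2)

/-- The cluster `C_i = {p_i^1, p_i^2, p_i^3, p_i^4}` of `Y_k`. -/
def Ycluster (i : ℕ) : Multiset (EuclideanSpace ℝ (Fin 2)) :=
  (Finset.univ : Finset (Fin 4)).val.map fun a => toE2 (Ypt i a)

/-- The partition `C = (C_1, …, C_k)` of `Y_k`. -/
def Ypartition (k : ℕ) : Multiset (Multiset (EuclideanSpace ℝ (Fin 2))) :=
  (Finset.range k).val.map fun i => Ycluster (i + 1)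

/-- The point-set `Y_k` (as a multiset of `4k` points in the plane). -/
def Yset (k : ℕ) : Multiset (EuclideanSpace ℝ (Fin 2)) := (Ypartition k).sum


/-- In a partition into at most `k` clusters other than the canonical one, some cluster
contains points with two different indices. -/
lemma exists_mixed_cluster {k : ℕ} {P : Finset (Finset (Fin k × Fin 2))}
    (hP : IsIdxPartition k P) (hne : P ≠ wCanonical k) :
    ∃ S ∈ P, ∃ x ∈ S, ∃ y ∈ S, x.1 < y.1 := by
  by_contra hcon
  obtain ⟨hcard, hnon, huniq⟩ := hP
  have hsame : ∀ S ∈ P, ∀ x ∈ S, ∀ y ∈ S, x.1 = y.1 := by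
    intro S hS x hx y hy
    by_contra hxy
    rcases lt_or_gt_of_ne hxy with h | h
    · exact hcon ⟨S, hS, x, hx, y, hy, h⟩
    · exact hcon ⟨S, hS, y, hy, x, hx, h⟩
  choose f hf _ using fun i : Fin k => huniq (i, 0)
  have hinj : Function.Injective f := fun i j hij =>
    hsame (f i) (hf i).1 (i, 0) (hf i).2 (j, 0) (hij ▸ (hf j).2)
  have himg : Finset.univ.image f = P := by
    apply Finset.eq_of_subset_of_card_le
    · intro S hS
      obtain ⟨i, -, rfl⟩ := Finset.mem_image.1 hS
      exact (hf i).1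
    · rw [Finset.card_image_of_injective _ hinj]
      simpa using hcard
  have hfi : ∀ i, f i = Finset.univ.filter fun x : Fin k × Fin 2 => x.1 = i := by
    intro i
    ext x
    simp only [Finset.mem_filter, Finset.mem_univ, true_and]
    refine ⟨fun hx => hsame (f i) (hf i).1 x hx (i, 0) (hf i).2, fun hx => ?_⟩
    obtain ⟨S, ⟨hSP, hxS⟩, -⟩ := huniq x
    obtain ⟨j, -, rfl⟩ := Finset.mem_image.1 (himg ▸ hSP)
    have hj : x.1 = j := hsame (f j) hSP x hxS (j, 0) (hf j).2
    rwa [← hx, hj]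
  apply hne
  rw [← himg, wCanonical]
  exact Finset.image_congr fun i _ => hfi i

lemma isIdxPartition_wCanonical (k : ℕ) : IsIdxPartition k (wCanonical k) := by
  refine ⟨?_, ?_, fun x => ?_⟩
  · exact Finset.card_image_le.trans (by simp)
  · intro S hS
    obtain ⟨i, -, rfl⟩ := Finset.mem_image.1 hS
    exact ⟨(i, 0), by simp⟩
  · refine ⟨Finset.univ.filter fun y : Fin k × Fin 2 => y.1 = x.1,
      ⟨Finset.mem_image_of_mem _ (Finset.mem_univ _), by simp⟩, ?_⟩
    rintro S ⟨hS, hx⟩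
    obtain ⟨i, -, rfl⟩ := Finset.mem_image.1 hS
    simp only [Finset.mem_filter, Finset.mem_univ, true_and] at hx
    rw [hx]

/-- Size and position estimates for the `i`-th pair `q` of the planar point-set built with
`h i = H ^ i`. -/
structure PlanarBounds (H : ℝ) (i : ℕ) (q : (ℝ × ℝ) × (ℝ × ℝ)) : Prop where
  lower : -(i : ℝ) ≤ q.1.1 ∧ -(i : ℝ) ≤ q.1.2 ∧ -(i : ℝ) ≤ q.2.1 ∧ -(i : ℝ) ≤ q.2.2
  upper : q.1.1 ≤ 2 * H ^ i ∧ q.1.2 ≤ 2 * H ^ i ∧ q.2.1 ≤ 2 * H ^ i ∧ q.2.2 ≤ 2 * H ^ i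
  odd : i % 2 = 1 → q.1.2 = q.2.2 ∧ 0 ≤ q.1.2 ∧ (2 ≤ i → H ^ i ≤ q.1.2)
  even : i % 2 = 0 → q.1.1 = q.2.1 ∧ 0 ≤ q.1.1 ∧ (2 ≤ i → H ^ i ≤ q.1.1)
  diff : |q.2.1 - q.1.1| ≤ 4 * H ^ (i - 1) ∧ |q.2.2 - q.1.2| ≤ 4 * H ^ (i - 1)

lemma planarBounds {H : ℝ} (hH : 4 ≤ H) :
    ∀ i : ℕ, (i : ℝ) ≤ H → PlanarBounds H i (planarP (fun j => H ^ j) i)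
  | 0, _ => by constructor <;> simp [planarP]
  | 1, _ => by
    constructor <;> simp [planarP]
    linarith
  | 2, _ => by
    have : 0 ≤ H ^ 2 := by positivity
    constructor <;> simp [planarP]
    · linarith
    · refine ⟨?_, ?_, ?_, ?_⟩ <;> linarith
    · linarith
    · linarith
  | i + 3, hi => by
    push_cast at hi
    have hb := planarBounds hH (i + 1) (by push_cast; linarith)
    have hb' := planarBounds hH (i + 2) (by push_cast; linarith)
    obtain ⟨⟨l1, l2, l3, l4⟩, ⟨u1, u2, u3, u4⟩, ho, he, -⟩ := hb
    obtain ⟨⟨l1', l2', l3', l4'⟩, ⟨u1', u2', u3', u4'⟩, -, -, -⟩ := hb'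
    push_cast at l1 l2 l3 l4 l1' l2' l3' l4'
    have p1 : H ≤ H ^ (i + 1) := le_self_pow₀ (by linarith) (by omega)
    have p2 : 4 * H ^ (i + 1) ≤ H ^ (i + 2) := by
      rw [pow_succ H (i + 1)]; nlinarith
    have p3 : 4 * H ^ (i + 2) ≤ H ^ (i + 3) := by
      rw [pow_succ H (i + 2)]; nlinarith
    have i0 : (0 : ℝ) ≤ i := Nat.cast_nonneg i
    rcases Nat.mod_two_eq_zero_or_one (i + 3) with hpar | hpar
    · obtain ⟨e1, e2, -⟩ := he (by omega)
      have hq : planarP (fun j => H ^ j) (i + 3) =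
          (((planarP (fun j => H ^ j) (i + 1)).1.1 + H ^ (i + 3),
            (planarP (fun j => H ^ j) (i + 1)).1.2 - 1),
           ((planarP (fun j => H ^ j) (i + 1)).2.1 + H ^ (i + 3),
            (planarP (fun j => H ^ j) (i + 2)).2.2 + 1)) := by
        simp [planarP, hpar]
      rw [hq]
      constructor
      · push_cast; refine ⟨?_, ?_, ?_, ?_⟩ <;> linarith
      · refine ⟨?_, ?_, ?_, ?_⟩ <;> linarith
      · omega
      · intro _; refine ⟨?_, ?_, fun _ => ?_⟩ <;> linarith
      · simp only [show i + 3 - 1 = i + 2 by omega, abs_le]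
        refine ⟨⟨?_, ?_⟩, ?_, ?_⟩ <;> linarith
    · obtain ⟨e1, e2, -⟩ := ho (by omega)
      have hq : planarP (fun j => H ^ j) (i + 3) =
          (((planarP (fun j => H ^ j) (i + 1)).1.1 - 1,
            (planarP (fun j => H ^ j) (i + 1)).1.2 + H ^ (i + 3)),
           ((planarP (fun j => H ^ j) (i + 2)).2.1 + 1,
            (planarP (fun j => H ^ j) (i + 1)).2.2 + H ^ (i + 3))) := by
        simp [planarP, hpar]
      rw [hq]
      constructor
      · push_cast; refine ⟨?_, ?_, ?_, ?_⟩ <;> linarith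
      · refine ⟨?_, ?_, ?_, ?_⟩ <;> linarith
      · intro _; refine ⟨?_, ?_, fun _ => ?_⟩ <;> linarith
      · omega
      · simp only [show i + 3 - 1 = i + 2 by omega, abs_le]
        refine ⟨⟨?_, ?_⟩, ?_, ?_⟩ <;> linarith

lemma norm_toE2_sub_sq (a b : ℝ × ℝ) :
    ‖toE2 a - toE2 b‖ ^ 2 = (a.1 - b.1) ^ 2 + (a.2 - b.2) ^ 2 := by
  rw [EuclideanSpace.norm_sq_eq]
  simp [toE2, Fin.sum_univ_two]

/-- Points of different clusters are far apart, at the scale of the later cluster. -/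
lemma norm_wpt_sub_sq_ge {k : ℕ} {H : ℝ} (hH : 4 ≤ H) (hk : (k : ℝ) ≤ H)
    {x y : Fin k × Fin 2} (hxy : x.1 < y.1) :
    (H ^ ((y.1 : ℕ) + 1)) ^ 2 / 4 ≤
      ‖wpt k (fun j => H ^ j) x - wpt k (fun j => H ^ j) y‖ ^ 2 := by
  have hle : ∀ i : Fin k, (((i : ℕ) + 1 : ℕ) : ℝ) ≤ H := fun i =>
    (Nat.cast_le.2 i.2).trans hk
  obtain ⟨-, ⟨u1, u2, u3, u4⟩, -, -, -⟩ := planarBounds hH _ (hle x.1)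
  obtain ⟨-, -, ho, he, -⟩ := planarBounds hH _ (hle y.1)
  have hlt : (x.1 : ℕ) < y.1 := hxy
  have hpow : 4 * H ^ ((x.1 : ℕ) + 1) ≤ H ^ ((y.1 : ℕ) + 1) := by
    have h1 : H ^ ((x.1 : ℕ) + 1 + 1) ≤ H ^ ((y.1 : ℕ) + 1) :=
      pow_le_pow_right₀ (by linarith) (by omega)
    have h2 : 0 < H ^ ((x.1 : ℕ) + 1) := by positivity
    rw [pow_succ H ((x.1 : ℕ) + 1)] at h1
    nlinarith
  have hpos : 0 < H ^ ((y.1 : ℕ) + 1) := by positivity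
  have key : ∀ a b : ℝ, a ≤ 2 * H ^ ((x.1 : ℕ) + 1) → H ^ ((y.1 : ℕ) + 1) ≤ b →
      (H ^ ((y.1 : ℕ) + 1)) ^ 2 / 4 ≤ (a - b) ^ 2 := by
    intro a b ha hb
    have : H ^ ((y.1 : ℕ) + 1) / 2 ≤ b - a := by linarith
    nlinarith
  unfold wpt
  rw [norm_toE2_sub_sq]
  rcases Nat.mod_two_eq_zero_or_one ((y.1 : ℕ) + 1) with hpar | hpar
  · obtain ⟨e1, -, e3⟩ := he hpar
    have e4 := e3 (by omega)
    refine le_add_of_le_of_nonneg (key _ _ ?_ ?_) (sq_nonneg _)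
    · split_ifs <;> assumption
    · split_ifs <;> linarith
  · obtain ⟨e1, -, e3⟩ := ho hpar
    have e4 := e3 (by omega)
    refine le_add_of_nonneg_of_le (sq_nonneg _) (key _ _ ?_ ?_)
    · split_ifs <;> assumption
    · split_ifs <;> linarith

lemma half_norm_sub_sq_le {E : Type*} [SeminormedAddCommGroup E] (x y c : E) :
    ‖x - y‖ ^ 2 / 2 ≤ ‖x - c‖ ^ 2 + ‖y - c‖ ^ 2 := by
  have h := norm_sub_le_norm_sub_add_norm_sub x c y
  rw [norm_sub_rev c y] at h
  nlinarith [sq_nonneg (‖x - c‖ - ‖y - c‖), norm_nonneg (x - y)]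

lemma bddBelow_weighted_means {E ι : Type*} [SeminormedAddCommGroup E] (S : Finset ι)
    {w : ι → ℝ} (hw : ∀ x, 0 ≤ w x) (q : ι → E) :
    BddBelow (Set.range fun c : E => ∑ x ∈ S, w x * ‖q x - c‖ ^ 2) := by
  refine ⟨0, ?_⟩
  rintro _ ⟨c, rfl⟩
  exact Finset.sum_nonneg fun x _ => mul_nonneg (hw x) (sq_nonneg _)

lemma wCostMeans_wCanonical_le {k : ℕ} {H : ℝ} (hH : 4 ≤ H) (hk : (k : ℝ) ≤ H) :
    wCostMeans k (fun j => H ^ j) (fun j => ((H ^ j) ^ 2)⁻¹) (wCanonical k) ≤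
      k * (32 / H ^ 2) := by
  have hH0 : 0 < H := by linarith
  have hterm : ∀ S ∈ wCanonical k, (⨅ c : EuclideanSpace ℝ (Fin 2),
      ∑ x ∈ S, ((H ^ ((x.1 : ℕ) + 1)) ^ 2)⁻¹ * ‖wpt k (fun j => H ^ j) x - c‖ ^ 2) ≤
        32 / H ^ 2 := by
    intro S hS
    obtain ⟨i, -, rfl⟩ := Finset.mem_image.1 hS
    refine (ciInf_le (bddBelow_weighted_means _ (fun x => by positivity) _)
      (wpt k (fun j => H ^ j) (i, 0))).trans ?_
    have hS : (Finset.univ.filter fun x : Fin k × Fin 2 => x.1 = i) = {(i, 0), (i, 1)} := by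
      ext ⟨a, b⟩
      fin_cases b <;> simp
    rw [hS, Finset.sum_pair (by simp)]
    obtain ⟨-, -, -, -, d1, d2⟩ := planarBounds hH ((i : ℕ) + 1) ((Nat.cast_le.2 i.2).trans hk)
    have hd1 := sq_le_sq' (abs_le.1 d1).1 (abs_le.1 d1).2
    have hd2 := sq_le_sq' (abs_le.1 d2).1 (abs_le.1 d2).2
    simp only [Nat.add_sub_cancel] at hd1 hd2
    have hn : ‖wpt k (fun j => H ^ j) (i, 1) - wpt k (fun j => H ^ j) (i, 0)‖ ^ 2 ≤
        32 * (H ^ (i : ℕ)) ^ 2 := by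
      simp only [wpt, if_true, one_ne_zero, if_false, norm_toE2_sub_sq]
      linarith
    simp only [sub_self, norm_zero]
    calc _ ≤ ((H ^ ((i : ℕ) + 1)) ^ 2)⁻¹ * 0 ^ 2 +
          ((H ^ ((i : ℕ) + 1)) ^ 2)⁻¹ * (32 * (H ^ (i : ℕ)) ^ 2) := by gcongr
      _ = 32 / H ^ 2 := by field_simp; ring
  calc _ ≤ (wCanonical k).card • (32 / H ^ 2) := Finset.sum_le_card_nsmul _ _ _ hterm
    _ ≤ k * (32 / H ^ 2) := by
      rw [nsmul_eq_mul]
      gcongr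
      exact (isIdxPartition_wCanonical k).1

lemma le_wCostMeans_of_ne_wCanonical {k : ℕ} {H : ℝ} (hH : 4 ≤ H) (hk : (k : ℝ) ≤ H)
    {P : Finset (Finset (Fin k × Fin 2))} (hP : IsIdxPartition k P) (hne : P ≠ wCanonical k) :
    1 / 8 ≤ wCostMeans k (fun j => H ^ j) (fun j => ((H ^ j) ^ 2)⁻¹) P := by
  have hH0 : 0 < H := by linarith
  obtain ⟨S, hS, x, hx, y, hy, hxy⟩ := exists_mixed_cluster hP hne
  refine le_trans ?_ (Finset.single_le_sum (fun T _ => Real.iInf_nonneg fun c =>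
    Finset.sum_nonneg fun z _ => by positivity) hS)
  refine le_ciInf fun c => ?_
  have hlt : (x.1 : ℕ) < y.1 := hxy
  have hsub : ({x, y} : Finset (Fin k × Fin 2)) ⊆ S := by
    intro z hz
    rcases Finset.mem_insert.1 hz with rfl | hz
    · exact hx
    · rwa [Finset.mem_singleton.1 hz]
  refine le_trans ?_ (Finset.sum_le_sum_of_subset_of_nonneg hsub
    fun z _ _ => by positivity)
  rw [Finset.sum_pair (fun h => hxy.ne (congrArg Prod.fst h))]
  have hw : ((H ^ ((y.1 : ℕ) + 1)) ^ 2)⁻¹ ≤ ((H ^ ((x.1 : ℕ) + 1)) ^ 2)⁻¹ := by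
    gcongr
    linarith
  calc (1 / 8 : ℝ) = ((H ^ ((y.1 : ℕ) + 1)) ^ 2)⁻¹ * ((H ^ ((y.1 : ℕ) + 1)) ^ 2 / 4 / 2) := by
        field_simp; norm_num
    _ ≤ ((H ^ ((y.1 : ℕ) + 1)) ^ 2)⁻¹ * (‖wpt k (fun j => H ^ j) x - c‖ ^ 2 +
          ‖wpt k (fun j => H ^ j) y - c‖ ^ 2) := by
        gcongr
        refine le_trans ?_ (half_norm_sub_sq_le _ _ c)
        gcongr
        exact norm_wpt_sub_sq_ge hH hk hxy
    _ ≤ _ := by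
        rw [mul_add]
        gcongr

/-- STATEMENT: the canonical partition `C = (C_1, …, C_k)` of `X(w, h)` is optimal for the
weighted k-means objective, and any other partition into at most `k` clusters costs at least
`p(2k)` times as much. -/
theorem stmt_10 (k : ℕ) (hk : 3 ≤ k) (p : ℕ → ℕ) :
    ∃ h w : ℕ → ℝ,
      (∀ i, 1 ≤ i → i ≤ k → 0 < h i) ∧ (∀ i, 1 ≤ i → i ≤ k → 0 < w i) ∧
      IsIdxPartition k (wCanonical k) ∧
      (∀ P, IsIdxPartition k P → wCostMeans k h w (wCanonical k) ≤ wCostMeans k h w P) ∧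
      ∀ P, IsIdxPartition k P → P ≠ wCanonical k →
        (p (2 * k) : ℝ) * wCostMeans k h w (wCanonical k) ≤ wCostMeans k h w P := by
  set H : ℝ := 16 * (k + 1) * (p (2 * k) + 1) with hHdef
  have hk0 : (0 : ℝ) ≤ k := Nat.cast_nonneg k
  have hp0 : (0 : ℝ) ≤ p (2 * k) := Nat.cast_nonneg _
  have hkH : 16 * ((k : ℝ) + 1) ≤ H := le_mul_of_one_le_right (by positivity) (by linarith)
  have hH : 4 ≤ H := by linarith
  have hkH' : (k : ℝ) ≤ H := by linarith
  have hH0 : 0 < H := by linarith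
  have hcan := wCostMeans_wCanonical_le (k := k) hH hkH'
  have hgap : ((p (2 * k) : ℝ) + 1) * (k * (32 / H ^ 2)) ≤ 1 / 8 := by
    rw [mul_div_assoc', mul_div_assoc', div_le_div_iff₀ (by positivity) (by norm_num)]
    have h1 : (k : ℝ) * (p (2 * k) + 1) ≤ ((k + 1) * (p (2 * k) + 1)) ^ 2 := by
      have ha : (k : ℝ) * (p (2 * k) + 1) ≤ (k + 1) * (p (2 * k) + 1) := by
        gcongr; linarith
      have hb : (1 : ℝ) ≤ (k + 1) * (p (2 * k) + 1) := by
        nlinarith [mul_nonneg hk0 hp0]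
      nlinarith
    have h2 : H ^ 2 = 256 * ((k + 1) * (p (2 * k) + 1)) ^ 2 := by rw [hHdef]; ring
    linarith
  have hother : ∀ P, IsIdxPartition k P → P ≠ wCanonical k →
      ((p (2 * k) : ℝ) + 1) *
        wCostMeans k (fun j => H ^ j) (fun j => ((H ^ j) ^ 2)⁻¹) (wCanonical k) ≤
          wCostMeans k (fun j => H ^ j) (fun j => ((H ^ j) ^ 2)⁻¹) P := fun P hP hne =>
    (mul_le_mul_of_nonneg_left hcan (by positivity)).trans
      (hgap.trans (le_wCostMeans_of_ne_wCanonical hH hkH' hP hne))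
  have hnonneg : 0 ≤ wCostMeans k (fun j => H ^ j) (fun j => ((H ^ j) ^ 2)⁻¹) (wCanonical k) :=
    Finset.sum_nonneg fun T _ => Real.iInf_nonneg fun c =>
      Finset.sum_nonneg fun z _ => by positivity
  refine ⟨fun j => H ^ j, fun j => ((H ^ j) ^ 2)⁻¹, fun i _ _ => by positivity,
    fun i _ _ => by positivity, isIdxPartition_wCanonical k, fun P hP => ?_,
    fun P hP hne => ?_⟩
  · by_cases hne : P = wCanonical k
    · rw [hne]
    · nlinarith [hother P hP hne, mul_nonneg hp0 hnonneg]
  · nlinarith [hother P hP hne]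

end
end

section
/- Let k ≥ 3 be an integer, let β ≥ 4 be a real number, and set h_i = β^i for i = 1,…,k; let w_1,…,w_k be arbitrary positive reals. Then there exists a threshold decision tree over ℝ² with k leaves and depth k−1 whose induced clustering of the 2k points of X(w,h) is exactly the partition C = (C_1,…,C_k). -/
noncomputable section

attribute [local instance] Classical.propDecidable

/-- The `i`-th cluster of `X(w, h)` lies on an axis-parallel line; `clusterLevel h i` is the
offset of that line. -/
def clusterLevel (h : ℕ → ℝ) : ℕ → ℝ
  | 0 => 0
  | 1 => 0
  | n + 2 => clusterLevel h n + h (n + 2)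

/-- The coordinate that is constant on the `i`-th cluster of `X(w, h)`. -/
def clusterAxis (i : ℕ) : Fin 2 := if i % 2 = 1 then 1 else 0

/-- The caterpillar tree with `n + 1` leaves that successively cuts off the clusters
`n + 1, n, …, 2`. -/
def caterpillar (h : ℕ → ℝ) : ℕ → TDT 2
  | 0 => TDT.leaf
  | n + 1 => TDT.node (clusterAxis (n + 2)) (clusterLevel h (n + 2)) (caterpillar h n) TDT.leaf

theorem caterpillar_leaves (h : ℕ → ℝ) (n : ℕ) : (caterpillar h n).leaves = n + 1 := by
  induction n with
  | zero => rfl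
  | succ n ih => simp [caterpillar, TDT.leaves, ih]

theorem caterpillar_depth (h : ℕ → ℝ) (n : ℕ) : (caterpillar h n).depth = n := by
  induction n with
  | zero => rfl
  | succ n ih => simp [caterpillar, TDT.depth, ih]

theorem clusterLevel_nonneg {h : ℕ → ℝ} (hh : ∀ i, 2 ≤ i → 1 < h i) (n : ℕ) :
    0 ≤ clusterLevel h n := by
  induction n using Nat.twoStepInduction with
  | zero => simp [clusterLevel]
  | one => simp [clusterLevel]
  | more n ih _ =>
    have := hh (n + 2) (by lia)
    simp only [clusterLevel]
    linarith

theorem clusterLevel_add_one_lt {h : ℕ → ℝ} (hh : ∀ i, 2 ≤ i → 1 < h i) (n m : ℕ) :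
    clusterLevel h n + 1 < clusterLevel h (n + 2 * (m + 1)) := by
  have step : ∀ j, clusterLevel h j + 1 < clusterLevel h (j + 2) := fun j => by
    have := hh (j + 2) (by lia)
    simp only [clusterLevel]
    linarith
  induction m with
  | zero => exact step n
  | succ m ih =>
    have := step (n + 2 * (m + 1))
    rw [show n + 2 * (m + 1 + 1) = n + 2 * (m + 1) + 2 by ring]
    linarith

theorem planarP_mem_strip {h : ℕ → ℝ} (n : ℕ) :
    ((n + 1) % 2 = 1 →
      (planarP h (n + 1)).1.2 = clusterLevel h (n + 1) ∧
      (planarP h (n + 1)).2.2 = clusterLevel h (n + 1) ∧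
      (planarP h (n + 1)).1.1 ≤ 0 ∧
      (planarP h (n + 1)).2.1 ≤ clusterLevel h n + 1) ∧
    ((n + 1) % 2 = 0 →
      (planarP h (n + 1)).1.1 = clusterLevel h (n + 1) ∧
      (planarP h (n + 1)).2.1 = clusterLevel h (n + 1) ∧
      (planarP h (n + 1)).1.2 ≤ 0 ∧
      (planarP h (n + 1)).2.2 ≤ clusterLevel h n + 1) := by
  induction n using Nat.twoStepInduction with
  | zero => simp [planarP, clusterLevel]
  | one => simp [planarP, clusterLevel]
  | more n ih ih' =>
    constructor <;> intro hn
    · obtain ⟨a, b, c, -⟩ := ih.1 (by lia)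
      obtain ⟨-, b', -, -⟩ := ih'.2 (by lia)
      have e : planarP h (n + 2 + 1) = _ := planarP.eq_4 h n
      rw [if_pos (by lia)] at e
      simp only [e, clusterLevel, a, b]
      refine ⟨trivial, trivial, by linarith, ?_⟩
      exact (congrArg (· + 1) b').le
    · obtain ⟨a, b, c, -⟩ := ih.2 (by lia)
      obtain ⟨-, b', -, -⟩ := ih'.1 (by lia)
      have e : planarP h (n + 2 + 1) = _ := planarP.eq_4 h n
      rw [if_neg (by lia)] at e
      simp only [e, clusterLevel, a, b]
      refine ⟨trivial, trivial, by linarith, ?_⟩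
      exact (congrArg (· + 1) b').le

theorem toE2_clusterAxis_self {h : ℕ → ℝ} (n : ℕ) :
    toE2 (planarP h (n + 1)).1 (clusterAxis (n + 1)) = clusterLevel h (n + 1) ∧
    toE2 (planarP h (n + 1)).2 (clusterAxis (n + 1)) = clusterLevel h (n + 1) := by
  obtain ⟨o, e⟩ := planarP_mem_strip (h := h) n
  rcases Nat.mod_two_eq_zero_or_one (n + 1) with hn | hn
  · simpa [toE2, clusterAxis, hn] using ⟨(e hn).1, (e hn).2.1⟩
  · simpa [toE2, clusterAxis, hn] using ⟨(o hn).1, (o hn).2.1⟩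

theorem toE2_clusterAxis_lt {h : ℕ → ℝ} (hh : ∀ i, 2 ≤ i → 1 < h i) {i n : ℕ} (hin : i < n) :
    toE2 (planarP h (i + 1)).1 (clusterAxis (n + 1)) < clusterLevel h (n + 1) ∧
    toE2 (planarP h (i + 1)).2 (clusterAxis (n + 1)) < clusterLevel h (n + 1) := by
  obtain ⟨o, e⟩ := planarP_mem_strip (h := h) i
  by_cases hp : (n + 1) % 2 = (i + 1) % 2
  · have hax : clusterAxis (n + 1) = clusterAxis (i + 1) := by simp only [clusterAxis, hp]
    obtain ⟨a, b⟩ := toE2_clusterAxis_self (h := h) i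
    obtain ⟨m, hm⟩ : ∃ m, n + 1 = i + 1 + 2 * (m + 1) := ⟨(n - i) / 2 - 1, by lia⟩
    have lt := clusterLevel_add_one_lt hh (i + 1) m
    rw [← hm] at lt
    rw [hax, a, b]
    constructor <;> linarith
  · obtain ⟨m, hm⟩ : ∃ m, n + 1 = i + 2 * (m + 1) := ⟨(n + 1 - i) / 2 - 1, by lia⟩
    have lt := clusterLevel_add_one_lt hh i m
    have nn := clusterLevel_nonneg hh i
    rw [← hm] at lt
    rcases Nat.mod_two_eq_zero_or_one (i + 1) with hi | hi
    · obtain ⟨-, -, a, b⟩ := e hi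
      have hn : (n + 1) % 2 = 1 := by lia
      simp only [toE2, clusterAxis, hn]
      constructor <;> simp <;> linarith
    · obtain ⟨-, -, a, b⟩ := o hi
      have hn : (n + 1) % 2 = 0 := by lia
      simp only [toE2, clusterAxis, hn]
      constructor <;> simp <;> linarith

theorem caterpillar_route {h : ℕ → ℝ} (hh : ∀ i, 2 ≤ i → 1 < h i) {i n : ℕ} (hin : i ≤ n) :
    (caterpillar h n).route (toE2 (planarP h (i + 1)).1) = i ∧
    (caterpillar h n).route (toE2 (planarP h (i + 1)).2) = i := by
  induction n with
  | zero => simp [caterpillar, TDT.route, Nat.le_zero.mp hin]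
  | succ n ih =>
    rcases hin.lt_or_eq with lt | rfl
    · obtain ⟨a, b⟩ := toE2_clusterAxis_lt hh lt
      simpa only [caterpillar, TDT.route, if_pos a, if_pos b] using ih (by lia)
    · obtain ⟨a, b⟩ := toE2_clusterAxis_self (h := h) (n + 1)
      simp only [caterpillar, TDT.route, a.not_lt, b.not_lt, if_false, caterpillar_leaves]
      simp

theorem treeIdxPartition_eq_wCanonical {k : ℕ} {t : TDT 2} {h : ℕ → ℝ} (hl : t.leaves = k)
    (hr : ∀ x : Fin k × Fin 2, t.route (wpt k h x) = x.1) :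
    treeIdxPartition k t h = wCanonical k := by
  ext S
  simp only [treeIdxPartition, wCanonical, hl, hr, Finset.mem_filter, Finset.mem_image,
    Finset.mem_range, Finset.mem_univ, true_and]
  constructor
  · rintro ⟨⟨l, hlk, rfl⟩, -⟩
    exact ⟨⟨l, hlk⟩, by ext x; simp [Fin.ext_iff]⟩
  · rintro ⟨i, rfl⟩
    exact ⟨⟨i, i.2, by ext x; simp [Fin.ext_iff]⟩, ⟨(i, 0), by simp⟩⟩

/-- STATEMENT: with `h_i = β^i` (`β ≥ 4`) and arbitrary positive weights, some threshold
decision tree with `k` leaves and depth `k - 1` induces on `X(w, h)` exactly the canonical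
partition `C = (C_1, …, C_k)`. -/
theorem stmt_12 (k : ℕ) (hk : 3 ≤ k) (β : ℝ) (hβ : 4 ≤ β) (w : ℕ → ℝ)
    (hw : ∀ i, 1 ≤ i → i ≤ k → 0 < w i) :
    ∃ t : TDT 2, t.leaves = k ∧ t.depth = k - 1 ∧
      treeIdxPartition k t (fun i => β ^ i) = wCanonical k := by
  have hh : ∀ i, 2 ≤ i → 1 < β ^ i := fun i hi =>
    one_lt_pow₀ (by linarith) (by lia)
  have hl : (caterpillar (fun i => β ^ i) (k - 1)).leaves = k := by
    rw [caterpillar_leaves]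
    lia
  refine ⟨_, hl, caterpillar_depth _ _, treeIdxPartition_eq_wCanonical hl fun x => ?_⟩
  obtain ⟨a, b⟩ := caterpillar_route (h := fun i => β ^ i) hh (Nat.le_sub_one_of_lt x.1.2)
  unfold wpt
  split_ifs
  exacts [a, b]

end
end

section
/- Let k ≥ 3 be an integer, let β ≥ 4 be a real number, and set h_i = β^i for i = 1,…,k. Then every threshold decision tree over ℝ² with k leaves and depth at most k−2 induces on the 2k points of X(w,h) a clustering different from the partition C = (C_1,…,C_k); that is, at least one point is misclassified with respect to C. -/
noncomputable section

attribute [local instance] Classical.propDecidable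

theorem TDT.route_lt_leaves {d : ℕ} (t : TDT d) (x : EuclideanSpace ℝ (Fin d)) :
    t.route x < t.leaves := by
  induction t with
  | leaf => simp [TDT.route, TDT.leaves]
  | node r θ l rt hl hr =>
    simp only [TDT.route, TDT.leaves]
    split_ifs <;> omega

/-- Suppose that for every `n ≥ 1` and every coordinate `r`, one of the pairs `n`, `n + 1` spans
the `r`-coordinates of the pairs `1, …, n`. Then every tree whose leaves separate exactly the
pairs `1, …, m` has depth at least `m - 1`: each cut leaves `m - 1` pairs on the same side. -/
theorem TDT.le_depth_add_one_of_spanning {d : ℕ} (p : ℕ → Fin 2 → EuclideanSpace ℝ (Fin d))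
    (hp : ∀ n, 1 ≤ n → ∀ r : Fin d, ∃ s, n ≤ s ∧ s ≤ n + 1 ∧
      ∀ j, 1 ≤ j → j ≤ n → ∀ b, p s 0 r ≤ p j b r ∧ p j b r ≤ p s 1 r)
    (t : TDT d) : ∀ m, (∀ i j a b, 1 ≤ i → i ≤ m → 1 ≤ j → j ≤ m →
      (t.route (p i a) = t.route (p j b) ↔ i = j)) → m ≤ t.depth + 1 := by
  induction t with
  | leaf =>
    intro m hm
    by_contra! hlt
    simp only [TDT.depth] at hlt
    have := (hm 1 2 0 0 (by omega) (by omega) (by omega) (by omega)).1 rfl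
    omega
  | node r θ l rt hl hr =>
    intro m hm
    simp only [TDT.depth]
    obtain hm1 | ⟨n, hn, rfl⟩ : m ≤ 1 ∨ ∃ n, 1 ≤ n ∧ m = n + 1 := by
      rcases Nat.lt_or_ge 1 m with h | h
      · exact Or.inr ⟨m - 1, by omega, by omega⟩
      · exact Or.inl h
    · omega
    obtain ⟨s, hs, hs', hspan⟩ := hp n hn r
    have hss := (hm s s 0 1 (by omega) hs' (by omega) hs').2 rfl
    have hlt := l.route_lt_leaves (p s 0)
    by_cases h0 : p s 0 r < θ
    · by_cases h1 : p s 1 r < θ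
      · have : n ≤ l.depth + 1 := hl n fun i j a b hi hi' hj hj' => by
          have h := hm i j a b hi (by omega) hj (by omega)
          rwa [TDT.route, TDT.route, if_pos ((hspan i hi hi' a).2.trans_lt h1),
            if_pos ((hspan j hj hj' b).2.trans_lt h1)] at h
        omega
      · rw [TDT.route, TDT.route, if_pos h0, if_neg h1] at hss
        omega
    · have : n ≤ rt.depth + 1 := hr n fun i j a b hi hi' hj hj' => by
        have h := hm i j a b hi (by omega) hj (by omega)
        rwa [TDT.route, TDT.route,
          if_neg fun hlt => h0 ((hspan i hi hi' a).1.trans_lt hlt),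
          if_neg fun hlt => h0 ((hspan j hj hj' b).1.trans_lt hlt), Nat.add_left_cancel_iff] at h
      omega

theorem planarP_odd (h : ℕ → ℝ) (i : ℕ) (hi : (i + 3) % 2 = 1) :
    planarP h (i + 3) =
      (((planarP h (i + 1)).1.1 - 1, (planarP h (i + 1)).1.2 + h (i + 3)),
        ((planarP h (i + 2)).2.1 + 1, (planarP h (i + 1)).2.2 + h (i + 3))) := by
  rw [planarP]
  simp only [if_pos hi]

theorem planarP_even (h : ℕ → ℝ) (i : ℕ) (hi : (i + 3) % 2 ≠ 1) :
    planarP h (i + 3) =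
      (((planarP h (i + 1)).1.1 + h (i + 3), (planarP h (i + 1)).1.2 - 1),
        ((planarP h (i + 1)).2.1 + h (i + 3), (planarP h (i + 2)).2.2 + 1)) := by
  rw [planarP]
  simp only [if_neg hi]

/-- The upper end of each pair exceeds that of its predecessor by at most `1`, in the
coordinate along which the pair extends. -/
theorem planarP_succ_le (h : ℕ → ℝ) (n : ℕ) (hn : 1 ≤ n) :
    ((n + 1) % 2 = 1 → (planarP h (n + 1)).2.1 ≤ (planarP h n).2.1 + 1) ∧
    ((n + 1) % 2 ≠ 1 → (planarP h (n + 1)).2.2 ≤ (planarP h n).2.2 + 1) := by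
  obtain rfl | ⟨i, rfl⟩ : n = 1 ∨ ∃ i, n = i + 2 := by
    rcases Nat.lt_or_ge 1 n with h | h
    · exact Or.inr ⟨n - 2, by omega⟩
    · exact Or.inl (by omega)
  · simp [planarP]
  · constructor <;> intro hi
    · rw [planarP_odd h i hi]
    · rw [planarP_even h i hi]

/-- The pair `n` spans one coordinate of all pairs `j ≤ n`, and is constant and maximal in
the other coordinate. -/
theorem planarP_spanning (h : ℕ → ℝ) (hh : ∀ i, 1 ≤ h i) (n : ℕ) (hn : 1 ≤ n) :
    (n % 2 = 1 → (planarP h n).1.2 = (planarP h n).2.2 ∧ ∀ j, 1 ≤ j → j ≤ n →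
      (planarP h n).1.1 ≤ (planarP h j).1.1 ∧ (planarP h n).1.1 ≤ (planarP h j).2.1 ∧
      (planarP h j).1.1 ≤ (planarP h n).2.1 ∧ (planarP h j).2.1 ≤ (planarP h n).2.1 ∧
      (planarP h j).1.2 ≤ (planarP h n).2.2 ∧ (planarP h j).2.2 ≤ (planarP h n).2.2) ∧
    (n % 2 ≠ 1 → (planarP h n).1.1 = (planarP h n).2.1 ∧ ∀ j, 1 ≤ j → j ≤ n →
      (planarP h n).1.2 ≤ (planarP h j).1.2 ∧ (planarP h n).1.2 ≤ (planarP h j).2.2 ∧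
      (planarP h j).1.2 ≤ (planarP h n).2.2 ∧ (planarP h j).2.2 ≤ (planarP h n).2.2 ∧
      (planarP h j).1.1 ≤ (planarP h n).2.1 ∧ (planarP h j).2.1 ≤ (planarP h n).2.1) := by
  induction n using Nat.strong_induction_on with
  | _ n ih =>
    obtain rfl | rfl | ⟨i, rfl⟩ : n = 1 ∨ n = 2 ∨ ∃ i, n = i + 3 := by
      rcases Nat.lt_or_ge 2 n with h | h
      · exact Or.inr (Or.inr ⟨n - 3, by omega⟩)
      · omega
    · refine ⟨fun _ => ⟨rfl, fun j hj hj' => ?_⟩, fun h => absurd rfl h⟩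
      obtain rfl : j = 1 := by omega
      simp [planarP]
    · refine ⟨fun h => by omega, fun _ => ⟨rfl, fun j hj hj' => ?_⟩⟩
      have := hh 2
      obtain rfl | rfl : j = 1 ∨ j = 2 := by omega
      · simp only [planarP]
        refine ⟨?_, ?_, ?_, ?_, ?_, ?_⟩ <;> linarith
      · simp [planarP]
    · obtain ⟨ho1, he1⟩ := ih (i + 1) (by omega) (by omega)
      obtain ⟨ho2, he2⟩ := ih (i + 2) (by omega) (by omega)
      obtain ⟨hso, hse⟩ := planarP_succ_le h (i + 1) (by omega)
      have hpos := hh (i + 3)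
      constructor <;> intro hi
      · obtain ⟨e1, f1⟩ := ho1 (by omega)
        obtain ⟨e2, f2⟩ := he2 (by omega)
        have hs := hse (by omega)
        rw [show i + 1 + 1 = i + 2 from rfl] at hs
        rw [planarP_odd h i hi]
        refine ⟨by simp only [e1], fun j hj hj' => ?_⟩
        have g1 := f2 (i + 1) (by omega) (by omega)
        have g2 := f1 (i + 1) (by omega) (by omega)
        obtain rfl | rfl | hj2 : j = i + 3 ∨ j = i + 2 ∨ j ≤ i + 1 := by omega
        · rw [planarP_odd h i hi]
          refine ⟨?_, ?_, ?_, ?_, ?_, ?_⟩ <;> dsimp only <;> linarith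
        · have g3 := f2 (i + 2) (by omega) (by omega)
          refine ⟨?_, ?_, ?_, ?_, ?_, ?_⟩ <;> dsimp only <;> linarith
        · have g3 := f2 j (by omega) (by omega)
          have g4 := f1 j (by omega) (by omega)
          refine ⟨?_, ?_, ?_, ?_, ?_, ?_⟩ <;> dsimp only <;> linarith
      · obtain ⟨e1, f1⟩ := he1 (by omega)
        obtain ⟨e2, f2⟩ := ho2 (by omega)
        have hs := hso (by omega)
        rw [show i + 1 + 1 = i + 2 from rfl] at hs
        rw [planarP_even h i hi]
        refine ⟨by simp only [e1], fun j hj hj' => ?_⟩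
        have g1 := f2 (i + 1) (by omega) (by omega)
        have g2 := f1 (i + 1) (by omega) (by omega)
        obtain rfl | rfl | hj2 : j = i + 3 ∨ j = i + 2 ∨ j ≤ i + 1 := by omega
        · rw [planarP_even h i hi]
          refine ⟨?_, ?_, ?_, ?_, ?_, ?_⟩ <;> dsimp only <;> linarith
        · have g3 := f2 (i + 2) (by omega) (by omega)
          refine ⟨?_, ?_, ?_, ?_, ?_, ?_⟩ <;> dsimp only <;> linarith
        · have g3 := f2 j (by omega) (by omega)
          have g4 := f1 j (by omega) (by omega)
          refine ⟨?_, ?_, ?_, ?_, ?_, ?_⟩ <;> dsimp only <;> linarith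

/-- `planarPoint h i a = p_i^{a+1}` as a point of the Euclidean plane. -/
def planarPoint (h : ℕ → ℝ) (i : ℕ) (a : Fin 2) : EuclideanSpace ℝ (Fin 2) :=
  toE2 (if a = (0 : Fin 2) then (planarP h i).1 else (planarP h i).2)

theorem planarPoint_spanning (h : ℕ → ℝ) (hh : ∀ i, 1 ≤ h i) (n : ℕ) (hn : 1 ≤ n)
    (r : Fin 2) : ∃ s, n ≤ s ∧ s ≤ n + 1 ∧ ∀ j, 1 ≤ j → j ≤ n → ∀ b,
      planarPoint h s 0 r ≤ planarPoint h j b r ∧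
        planarPoint h j b r ≤ planarPoint h s 1 r := by
  obtain ⟨s, hs, hs', hpar⟩ : ∃ s, n ≤ s ∧ s ≤ n + 1 ∧ (s % 2 = 1 ↔ r = 0) := by
    rcases Nat.mod_two_eq_zero_or_one n with hp | hp <;> by_cases hr : r = 0
    · exact ⟨n + 1, by omega, le_rfl, by simp only [hr, iff_true]; omega⟩
    · exact ⟨n, le_rfl, by omega, by simp only [hr, iff_false]; omega⟩
    · exact ⟨n, le_rfl, by omega, by simp only [hr, iff_true]; omega⟩
    · exact ⟨n + 1, by omega, le_rfl, by simp only [hr, iff_false]; omega⟩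
  refine ⟨s, hs, hs', fun j hj hj' b => ?_⟩
  obtain ⟨ho, he⟩ := planarP_spanning h hh s (by omega)
  fin_cases r
  · have g := (ho (hpar.2 rfl)).2 j hj (by omega)
    fin_cases b <;> simp [planarPoint, toE2] <;> tauto
  · have g := (he fun h1 => absurd (hpar.1 h1) (by decide)).2 j hj (by omega)
    fin_cases b <;> simp [planarPoint, toE2] <;> tauto

theorem route_eq_iff_of_treeIdxPartition_eq {k : ℕ} {t : TDT 2} {h : ℕ → ℝ}
    (heq : treeIdxPartition k t h = wCanonical k) (x y : Fin k × Fin 2) :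
    t.route (wpt k h x) = t.route (wpt k h y) ↔ x.1 = y.1 := by
  have hmem : (Finset.univ.filter fun z : Fin k × Fin 2 => z.1 = y.1) ∈
      treeIdxPartition k t h := by
    rw [heq]
    exact Finset.mem_image_of_mem _ (Finset.mem_univ _)
  obtain ⟨c, -, hc⟩ := Finset.mem_image.1 (Finset.mem_filter.1 hmem).1
  have hiff (z : Fin k × Fin 2) : t.route (wpt k h z) = c ↔ z.1 = y.1 := by
    have := Finset.ext_iff.1 hc z
    simpa only [Finset.mem_filter, Finset.mem_univ, true_and] using this
  rw [(hiff y).2 rfl, hiff x]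

/-- STATEMENT: with `h_i = β^i` (`β ≥ 4`), every threshold decision tree with `k` leaves
and depth at most `k - 2` induces on `X(w, h)` a partition different from the canonical
partition `C = (C_1, …, C_k)`, i.e. misclassifies at least one point. -/
theorem stmt_13 (k : ℕ) (hk : 3 ≤ k) (β : ℝ) (hβ : 4 ≤ β) :
    ∀ t : TDT 2, t.leaves = k → t.depth ≤ k - 2 →
      treeIdxPartition k t (fun i => β ^ i) ≠ wCanonical k := by
  intro t _ hdepth heq
  have hle := t.le_depth_add_one_of_spanning (planarPoint fun i => β ^ i)
    (planarPoint_spanning _ fun i => one_le_pow₀ (by linarith)) k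
    fun i j a b hi hi' hj hj' => by
      have h := route_eq_iff_of_treeIdxPartition_eq heq
        (⟨i - 1, by omega⟩, a) (⟨j - 1, by omega⟩, b)
      simp only [wpt, Nat.sub_add_cancel hi, Nat.sub_add_cancel hj, Fin.mk.injEq] at h
      exact h.trans (by omega)
  omega

end
end

section
/- For every integer k ≥ 3, there exists a threshold decision tree over ℝ² with k leaves and depth k−1 whose induced clustering of Y_k is exactly the partition C = (C_1,…,C_k); moreover, the k-center cost of the partition C equals 1/2. -/
noncomputable section

attribute [local instance] Classical.propDecidable

/-- The offset of the `a`-th point of a cluster of `Y_k` from the center of that cluster. -/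
def Yoffset : Fin 4 → ℝ × ℝ := ![(0, -1 / 2), (-1 / 2, 0), (0, 1 / 2), (1 / 2, 0)]

/-- The center of the cluster `C_i` of `Y_k`. -/
def Ycenter : ℕ → ℝ × ℝ
  | 0 => (0, 0)
  | 1 => (-1, 1 / 2)
  | 2 => (1, 1 / 2)
  | 3 => (0, 5 / 2)
  | 4 => (3, 3 / 2)
  | i + 5 => Ycenter (i + 3) + (2, 2)

theorem Ypt_eq_Ycenter_add (i : ℕ) (hi : 1 ≤ i) (a : Fin 4) :
    Ypt i a = Ycenter i + Yoffset a := by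
  induction i using Ycenter.induct with
  | case1 => omega
  | case6 i ih => rw [Ypt, Ycenter, ih (by omega)]; abel
  | _ =>
    fin_cases a <;> simp [Ypt, Ycenter, Yoffset, Ybase1, Ybase2] <;> norm_num

theorem Ycenter_of_odd (i : ℕ) (hi : i % 2 = 1) :
    (Ycenter i).1 ≤ i - 2 ∧ (Ycenter i).2 = i - 1 / 2 := by
  induction i using Ycenter.induct with
  | case6 i ih =>
    obtain ⟨h₁, h₂⟩ := ih (by omega)
    rw [Ycenter]
    push_cast at *
    constructor <;> simp only [Prod.fst_add, Prod.snd_add] <;> linarith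
  | _ => first | omega | norm_num [Ycenter]

theorem Ycenter_of_even (i : ℕ) (hi : i % 2 = 0) (hi' : 1 ≤ i) :
    (Ycenter i).1 = i - 1 ∧ (Ycenter i).2 ≤ i - 3 / 2 := by
  induction i using Ycenter.induct with
  | case6 i ih =>
    obtain ⟨h₁, h₂⟩ := ih (by omega) (by omega)
    rw [Ycenter]
    push_cast at *
    constructor <;> simp only [Prod.fst_add, Prod.snd_add] <;> linarith
  | _ => first | omega | norm_num [Ycenter]

theorem abs_Yoffset_le (a : Fin 4) : |(Yoffset a).1| ≤ 1 / 2 ∧ |(Yoffset a).2| ≤ 1 / 2 := by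
  fin_cases a <;> norm_num [Yoffset, abs_le]

/-- The caterpillar tree with `n + 1` leaves that splits off the clusters
`C_{n+1}, C_n, …, C_2` of `Y_{n+1}` one at a time. -/
def Ytree : ℕ → TDT 2
  | 0 => .leaf
  | n + 1 =>
    if n % 2 = 0 then .node 0 n (Ytree n) .leaf else .node 1 (n + 1 / 2) (Ytree n) .leaf

theorem leaves_Ytree (n : ℕ) : (Ytree n).leaves = n + 1 := by
  induction n with
  | zero => rfl
  | succ n ih => rw [Ytree]; split_ifs <;> simp [TDT.leaves, ih]

theorem depth_Ytree (n : ℕ) : (Ytree n).depth = n := by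
  induction n with
  | zero => rfl
  | succ n ih => rw [Ytree]; split_ifs <;> simp [TDT.depth, ih]

theorem route_Ytree (n i : ℕ) (hi : i ≤ n) (a : Fin 4) :
    (Ytree n).route (toE2 (Ypt (i + 1) a)) = i := by
  induction n with
  | zero => simp [Ytree, TDT.route]; omega
  | succ n ih =>
    obtain ⟨hx, hy⟩ := abs_Yoffset_le a
    rw [abs_le] at hx hy
    have hodd := Ycenter_of_odd (i + 1)
    have heven := fun h => Ycenter_of_even (i + 1) h (by omega)
    have hpt := Ypt_eq_Ycenter_add (i + 1) (by omega) a
    have hx0 : toE2 (Ypt (i + 1) a) 0 = (Ycenter (i + 1)).1 + (Yoffset a).1 := by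
      rw [hpt]; rfl
    have hx1 : toE2 (Ypt (i + 1) a) 1 = (Ycenter (i + 1)).2 + (Yoffset a).2 := by
      rw [hpt]; rfl
    push_cast at hodd heven
    rw [Ytree]
    rcases Nat.lt_or_ge n i with hni | hin
    · obtain rfl : i = n + 1 := by omega
      push_cast at hodd heven
      split_ifs with hpar
      · obtain ⟨h, -⟩ := heven (by omega)
        rw [TDT.route, if_neg (by rw [hx0]; linarith), leaves_Ytree, TDT.route]
      · obtain ⟨-, h⟩ := hodd (by omega)
        rw [TDT.route, if_neg (by rw [hx1]; linarith), leaves_Ytree, TDT.route]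
    · have hin' : (i : ℝ) ≤ n := by exact_mod_cast hin
      split_ifs with hpar
      · rw [TDT.route, if_pos, ih hin]
        rw [hx0]
        rcases Nat.mod_two_eq_zero_or_one (i + 1) with h | h
        · have : (i : ℝ) + 1 ≤ n := by exact_mod_cast (by omega : i + 1 ≤ n)
          linarith [(heven h).1]
        · linarith [(hodd h).1]
      · rw [TDT.route, if_pos, ih hin]
        rw [hx1]
        rcases Nat.mod_two_eq_zero_or_one (i + 1) with h | h
        · linarith [(heven h).2]
        · have : (i : ℝ) + 1 ≤ n := by exact_mod_cast (by omega : i + 1 ≤ n)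
          linarith [(hodd h).2]

theorem Ycluster_ne_zero (i : ℕ) : Ycluster i ≠ 0 := by
  rw [← Multiset.card_pos]
  simp [Ycluster]

theorem filter_sum_eq_of_labels {α : Type*} (k l : ℕ) (hl : l < k) (f : α → ℕ)
    (C : ℕ → Multiset α) (hf : ∀ i < k, ∀ x ∈ C i, f x = i) :
    (∑ i ∈ Finset.range k, C i).filter (fun x => f x = l) = C l := by
  have key : (∑ i ∈ Finset.range k, C i).filter (fun x => f x = l) =
      ∑ i ∈ Finset.range k, (C i).filter (fun x => f x = l) :=
    map_sum (⟨⟨Multiset.filter (fun x => f x = l), Multiset.filter_zero _⟩,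
      fun s t => Multiset.filter_add _ s t⟩ : Multiset α →+ Multiset α) C (Finset.range k)
  rw [key, Finset.sum_eq_single_of_mem l (Finset.mem_range.2 hl), Multiset.filter_eq_self]
  · exact hf l hl
  · intro i hi hil
    rw [Multiset.filter_eq_nil]
    intro x hx h
    exact hil ((hf i (Finset.mem_range.1 hi) x hx).symm.trans h)

theorem clustering_Ytree (n : ℕ) :
    (Ytree n).clustering (Yset (n + 1)) = Ypartition (n + 1) := by
  have hmap : ((Finset.range (n + 1)).val.map fun i =>
      (Yset (n + 1)).filter fun x => (Ytree n).route x = i) = Ypartition (n + 1) := by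
    refine Multiset.map_congr rfl fun l hl => ?_
    refine filter_sum_eq_of_labels (n + 1) l (Finset.mem_range.1 hl) _
      (fun i => Ycluster (i + 1)) fun i hi x hx => ?_
    obtain ⟨a, -, rfl⟩ := Multiset.mem_map.1 hx
    exact route_Ytree n i (by omega) a
  rw [TDT.clustering, leaves_Ytree, hmap, Multiset.filter_eq_self]
  intro C hC
  obtain ⟨i, -, rfl⟩ := Multiset.mem_map.1 hC
  exact Ycluster_ne_zero _

theorem costCenter1_le {d : ℕ} {C : Multiset (EuclideanSpace ℝ (Fin d))}
    (c : EuclideanSpace ℝ (Fin d)) {r : ℝ} (hr : 0 ≤ r) (h : ∀ x ∈ C, ‖x - c‖ ≤ r) :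
    costCenter1 C ≤ r := by
  refine (ciInf_le ⟨0, ?_⟩ c).trans (Real.sSup_le ?_ hr)
  · rintro _ ⟨c', rfl⟩
    refine Real.sSup_nonneg ?_
    rintro _ ⟨x, -, rfl⟩
    exact norm_nonneg _
  · rintro _ ⟨x, hx, rfl⟩
    exact h x hx

theorem half_dist_le_costCenter1 {d : ℕ} {C : Multiset (EuclideanSpace ℝ (Fin d))}
    {x y : EuclideanSpace ℝ (Fin d)} (hx : x ∈ C) (hy : y ∈ C) :
    dist x y / 2 ≤ costCenter1 C := by
  refine le_ciInf fun c => ?_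
  have hbdd : BddAbove ((fun x => ‖x - c‖) '' {x | x ∈ C}) :=
    (C.finite_toSet.image _).bddAbove
  have h₁ := le_csSup hbdd ⟨x, hx, rfl⟩
  have h₂ := le_csSup hbdd ⟨y, hy, rfl⟩
  have h₃ := dist_triangle_right x y c
  simp only [dist_eq_norm] at *
  linarith

theorem toE2_sub (p q : ℝ × ℝ) : toE2 p - toE2 q = toE2 (p - q) := by
  ext j
  fin_cases j <;> rfl

theorem norm_toE2 (p : ℝ × ℝ) : ‖toE2 p‖ = √(p.1 ^ 2 + p.2 ^ 2) := by
  simp [EuclideanSpace.norm_eq, toE2]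

theorem norm_toE2_Yoffset (a : Fin 4) : ‖toE2 (Yoffset a)‖ = 1 / 2 := by
  rw [norm_toE2, Real.sqrt_eq_iff_mul_self_eq_of_pos (by norm_num)]
  fin_cases a <;> norm_num [Yoffset]

theorem costCenter1_Ycluster (i : ℕ) (hi : 1 ≤ i) : costCenter1 (Ycluster i) = 1 / 2 := by
  have hmem (a : Fin 4) : toE2 (Ypt i a) ∈ Ycluster i :=
    Multiset.mem_map_of_mem _ (Finset.mem_univ a)
  apply le_antisymm
  · refine costCenter1_le (toE2 (Ycenter i)) (by norm_num) fun x hx => ?_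
    obtain ⟨a, -, rfl⟩ := Multiset.mem_map.1 hx
    rw [toE2_sub, Ypt_eq_Ycenter_add i hi, add_sub_cancel_left, norm_toE2_Yoffset]
  · have hdist : dist (toE2 (Ypt i 2)) (toE2 (Ypt i 0)) = 1 := by
      rw [dist_eq_norm, toE2_sub, Ypt_eq_Ycenter_add i hi, Ypt_eq_Ycenter_add i hi,
        add_sub_add_left_eq_sub, norm_toE2]
      have h₂ : Yoffset 2 = (0, 1 / 2) := rfl
      have h₀ : Yoffset 0 = (0, -1 / 2) := rfl
      norm_num [h₂, h₀]
    exact hdist ▸ half_dist_le_costCenter1 (hmem 2) (hmem 0)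

theorem costCenter_Ypartition (k : ℕ) (hk : 1 ≤ k) : costCenter (Ypartition k) = 1 / 2 := by
  have hne : {C | C ∈ Ypartition k}.Nonempty := by
    refine ⟨Ycluster 1, ?_⟩
    rw [Set.mem_ofPred_eq, Ypartition, Multiset.mem_map]
    exact ⟨0, Finset.mem_range.2 hk, rfl⟩
  have himage : costCenter1 '' {C | C ∈ Ypartition k} = {1 / 2} := by
    refine (hne.image _).subset_singleton_iff.1 ?_
    rintro _ ⟨C, hC, rfl⟩
    rw [Set.mem_ofPred_eq, Ypartition, Multiset.mem_map] at hC
    obtain ⟨i, -, rfl⟩ := hC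
    exact costCenter1_Ycluster _ (by omega)
  rw [costCenter, himage, csSup_singleton]

/-- STATEMENT: some threshold decision tree with `k` leaves and depth `k - 1` induces on
`Y_k` exactly the partition `C = (C_1, …, C_k)`, whose k-center cost is `1/2`. -/
theorem stmt_15 (k : ℕ) (hk : 3 ≤ k) :
    (∃ t : TDT 2, t.leaves = k ∧ t.depth = k - 1 ∧
      t.clustering (Yset k) = Ypartition k) ∧
    costCenter (Ypartition k) = 1 / 2 := by
  obtain ⟨n, rfl⟩ : ∃ n, k = n + 1 := ⟨k - 1, by omega⟩
  exact ⟨⟨Ytree n, leaves_Ytree n, depth_Ytree n, clustering_Ytree n⟩,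
    costCenter_Ypartition _ (by omega)⟩

end
end

section
/- For every integer k ≥ 3, every threshold decision tree over ℝ² with k leaves and depth at most k−2 induces on Y_k a clustering different from the partition C = (C_1,…,C_k); that is, at least one point of Y_k is misclassified with respect to C. -/
noncomputable section

attribute [local instance] Classical.propDecidable

/-- `t` routes points of the first `j` clusters of `Y_k` to a common leaf exactly when they
belong to the same cluster. -/
def TDT.Separates (t : TDT 2) (j : ℕ) : Prop :=
  ∀ i i' : ℕ, 1 ≤ i → i ≤ j → 1 ≤ i' → i' ≤ j → ∀ a b : Fin 4,
    t.route (toE2 (Ypt i a)) = t.route (toE2 (Ypt i' b)) ↔ i = i'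

theorem toE2_zero (q : ℝ × ℝ) : toE2 q 0 = q.1 := rfl

theorem toE2_one (q : ℝ × ℝ) : toE2 q 1 = q.2 := rfl

/-- The `r`-coordinate projections of the `i`-th and the `i'`-th cluster of `Y_k` meet. -/
def YTouch (r : Fin 2) (i i' : ℕ) : Prop :=
  ∃ a b, toE2 (Ypt i a) r = toE2 (Ypt i' b) r

theorem YTouch.add_two {r : Fin 2} {i i' : ℕ} (h : YTouch r (i + 3) (i' + 3)) :
    YTouch r (i + 5) (i' + 5) := by
  obtain ⟨a, b, h⟩ := h
  refine ⟨a, b, ?_⟩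
  fin_cases r <;> simpa [toE2_zero, toE2_one, Ypt] using h

theorem YTouch.add_two_mul {r : Fin 2} {i i' : ℕ} (h : YTouch r (i + 3) (i' + 3)) (m : ℕ) :
    YTouch r (2 * m + i + 3) (2 * m + i' + 3) := by
  induction m with
  | zero => simpa using h
  | succ m ih =>
    have := ih.add_two
    rwa [show 2 * (m + 1) + i + 3 = 2 * m + i + 5 by ring,
      show 2 * (m + 1) + i' + 3 = 2 * m + i' + 5 by ring]

theorem yTouch_zero_one_three : YTouch 0 1 3 :=
  ⟨3, 1, by
    simp only [toE2_zero, Ypt, Ybase1, Matrix.cons_val, Prod.fst_add]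
    norm_num⟩

theorem yTouch_zero_two_three : YTouch 0 2 3 :=
  ⟨1, 3, by
    simp only [toE2_zero, Ypt, Ybase1, Ybase2, Matrix.cons_val, Prod.fst_add]
    norm_num⟩

theorem yTouch_zero_two_five : YTouch 0 2 5 :=
  ⟨3, 1, by
    simp only [toE2_zero, Ypt, Ybase1, Ybase2, Matrix.cons_val, Prod.fst_add]
    norm_num⟩

theorem yTouch_zero_even_succ (m : ℕ) : YTouch 0 (2 * m + 4) (2 * m + 5) :=
  YTouch.add_two_mul (i := 1) (i' := 2)
    ⟨1, 3, by
      simp only [toE2_zero, Ypt, Ybase1, Ybase2, Matrix.cons_val, Prod.fst_add]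
      norm_num⟩ m

theorem yTouch_zero_even_add_three (m : ℕ) : YTouch 0 (2 * m + 4) (2 * m + 7) :=
  YTouch.add_two_mul (i := 1) (i' := 4)
    ⟨3, 1, by
      simp only [toE2_zero, Ypt, Ybase1, Ybase2, Matrix.cons_val, Prod.fst_add]
      norm_num⟩ m

theorem yTouch_one_one_two : YTouch 1 1 2 :=
  ⟨0, 0, by simp [toE2_one, Ypt, Ybase1, Ybase2]⟩

theorem yTouch_one_one_four : YTouch 1 1 4 :=
  ⟨2, 0, by
    simp only [toE2_one, Ypt, Ybase1, Ybase2, Matrix.cons_val, Prod.snd_add]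
    norm_num⟩

theorem yTouch_one_odd_succ (m : ℕ) : YTouch 1 (2 * m + 3) (2 * m + 4) :=
  YTouch.add_two_mul (i := 0) (i' := 1)
    ⟨0, 2, by
      simp only [toE2_one, Ypt, Ybase1, Ybase2, Matrix.cons_val, Prod.snd_add]
      norm_num⟩ m

theorem yTouch_one_odd_add_three (m : ℕ) : YTouch 1 (2 * m + 3) (2 * m + 6) :=
  YTouch.add_two_mul (i := 0) (i' := 3)
    ⟨2, 0, by
      simp only [toE2_one, Ypt, Ybase1, Ybase2, Matrix.cons_val, Prod.snd_add]
      norm_num⟩ m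

/-- A property of clusters that agrees on touching clusters among the first `j` ones is
constant on the first `j - 1` ones. -/
theorem iff_one_of_yTouch {r : Fin 2} {j : ℕ} {P : ℕ → Prop}
    (hP : ∀ i i', 1 ≤ i → i ≤ j → 1 ≤ i' → i' ≤ j → YTouch r i i' → (P i ↔ P i')) :
    ∀ i, 1 ≤ i → i < j → (P i ↔ P 1) := by
  intro i
  induction i using Nat.strong_induction_on with
  | _ i ih =>
  intro h1 hj
  rcases (show i = 1 ∨ i = 2 ∨ i = 3 ∨ i = 4 ∨ (∃ m, i = 2 * m + 5) ∨ ∃ m, i = 2 * m + 6 by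
    rcases Nat.even_or_odd' i with ⟨n, h | h⟩
    · by_cases hn : n < 3
      · omega
      · exact .inr (.inr (.inr (.inr (.inr ⟨n - 3, by omega⟩))))
    · by_cases hn : n < 2
      · omega
      · exact .inr (.inr (.inr (.inr (.inl ⟨n - 2, by omega⟩))))) with
    rfl | rfl | rfl | rfl | ⟨m, rfl⟩ | ⟨m, rfl⟩
  · rfl
  all_goals fin_cases r
  · have e := hP 2 3 (by omega) (by omega) (by omega) (by omega) yTouch_zero_two_three
    have f := hP 1 3 (by omega) (by omega) (by omega) (by omega) yTouch_zero_one_three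
    exact e.trans f.symm
  · exact (hP 1 2 (by omega) (by omega) (by omega) (by omega) yTouch_one_one_two).symm
  · exact (hP 1 3 (by omega) (by omega) (by omega) (by omega) yTouch_zero_one_three).symm
  · have e := hP 3 4 (by omega) (by omega) (by omega) (by omega) (yTouch_one_odd_succ 0)
    have f := hP 1 4 (by omega) (by omega) (by omega) (by omega) yTouch_one_one_four
    exact e.trans f.symm
  · have e := hP 4 5 (by omega) (by omega) (by omega) (by omega) (yTouch_zero_even_succ 0)
    have f := hP 2 5 (by omega) (by omega) (by omega) (by omega) yTouch_zero_two_five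
    exact (e.trans f.symm).trans (ih 2 (by omega) (by omega) (by omega))
  · exact (hP 1 4 (by omega) (by omega) (by omega) (by omega) yTouch_one_one_four).symm
  · refine Iff.trans ?_ (ih (2 * m + 2) (by omega) (by omega) (by omega))
    refine (hP _ _ (by omega) (by omega) (by omega) (by omega) ?_).symm
    cases m with
    | zero => exact yTouch_zero_two_five
    | succ m => exact yTouch_zero_even_add_three m
  · have e := hP _ _ (by omega) (by omega) (by omega) (by omega) (yTouch_one_odd_succ (m + 1))
    have f := hP _ _ (by omega) (by omega) (by omega) (by omega) (yTouch_one_odd_add_three m)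
    exact (e.trans f.symm).trans (ih (2 * m + 3) (by omega) (by omega) (by omega))
  · have e := hP _ _ (by omega) (by omega) (by omega) (by omega) (yTouch_zero_even_succ (m + 1))
    have f := hP _ _ (by omega) (by omega) (by omega) (by omega) (yTouch_zero_even_add_three m)
    exact (e.trans f.symm).trans (ih (2 * m + 4) (by omega) (by omega) (by omega))
  · have f := hP _ _ (by omega) (by omega) (by omega) (by omega) (yTouch_one_odd_add_three m)
    exact f.symm.trans (ih (2 * m + 3) (by omega) (by omega) (by omega))

theorem TDT.Separates.le_depth_add_one {t : TDT 2} {j : ℕ} (h : t.Separates j) :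
    j ≤ t.depth + 1 := by
  induction t generalizing j with
  | leaf =>
    by_contra! hj
    simp only [TDT.depth] at hj
    exact absurd ((h 1 2 (by omega) (by omega) (by omega) (by omega) 0 0).1 rfl) (by omega)
  | node r θ l rt ihl ihr =>
    have hcluster : ∀ i, 1 ≤ i → i ≤ j → ∀ a b,
        (toE2 (Ypt i a) r < θ ↔ toE2 (Ypt i b) r < θ) := by
      intro i h1 hj a b
      have e := (h i i h1 hj h1 hj a b).2 rfl
      have ha := l.route_lt_leaves (toE2 (Ypt i a))
      have hb := l.route_lt_leaves (toE2 (Ypt i b))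
      simp only [TDT.route] at e
      split_ifs at e with hl hr hr
      · simp [hl, hr]
      · omega
      · omega
      · simp [hl, hr]
    have hside : ∀ i, 1 ≤ i → i < j → ∀ a,
        (toE2 (Ypt i a) r < θ ↔ toE2 (Ypt 1 0) r < θ) := by
      intro i h1 hj a
      refine (hcluster i h1 hj.le a 0).trans ?_
      refine iff_one_of_yTouch (r := r) (j := j) (P := fun i => toE2 (Ypt i 0) r < θ) ?_ i h1 hj
      rintro i i' hi hi2 hi' hi2' ⟨a, b, hab⟩
      have e := hcluster i hi hi2 0 a
      rw [hab] at e
      exact e.trans (hcluster i' hi' hi2' b 0)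
    by_cases hθ : toE2 (Ypt 1 0) r < θ
    · have hsep : l.Separates (j - 1) := by
        intro i i' hi hij hi' hij' a b
        rw [← h i i' hi (by omega) hi' (by omega) a b]
        simp [TDT.route, (hside i hi (by omega) a).2 hθ, (hside i' hi' (by omega) b).2 hθ]
      have := ihl hsep
      simp only [TDT.depth]
      omega
    · have hsep : rt.Separates (j - 1) := by
        intro i i' hi hij hi' hij' a b
        rw [← h i i' hi (by omega) hi' (by omega) a b]
        simp only [TDT.route, if_neg (mt (hside i hi (by omega) a).1 hθ),
          if_neg (mt (hside i' hi' (by omega) b).1 hθ)]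
        omega
      have := ihr hsep
      simp only [TDT.depth]
      omega

theorem toE2_Ypt_mem_Ycluster (i : ℕ) (a : Fin 4) : toE2 (Ypt i a) ∈ Ycluster i :=
  Multiset.mem_map_of_mem _ (Finset.mem_univ a)

theorem card_Ycluster (i : ℕ) : Multiset.card (Ycluster i) = 4 := by
  simp [Ycluster]

theorem TDT.separates_of_clustering_eq {t : TDT 2} {k : ℕ}
    (h : t.clustering (Yset k) = Ypartition k) : t.Separates k := by
  have hfiber : ∀ i, 1 ≤ i → i ≤ k →
      ∃ n, Ycluster i = (Yset k).filter fun x => t.route x = n := by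
    intro i hi hik
    have hmem : Ycluster i ∈ t.clustering (Yset k) := by
      rw [h]
      exact Multiset.mem_map.2 ⟨i - 1, Finset.mem_range.2 (by omega), by
        rw [Nat.sub_add_cancel hi]⟩
    obtain ⟨n, -, hn⟩ := Multiset.mem_map.1 (Multiset.mem_filter.1 hmem).1
    exact ⟨n, hn.symm⟩
  have hroute : ∀ {i n}, (Ycluster i = (Yset k).filter fun x => t.route x = n) →
      ∀ x ∈ Ycluster i, t.route x = n := by
    intro i n hn x hx
    rw [hn] at hx
    exact (Multiset.mem_filter.1 hx).2
  intro i i' hi hik hi' hik' a b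
  obtain ⟨n, hn⟩ := hfiber i hi hik
  obtain ⟨n', hn'⟩ := hfiber i' hi' hik'
  have ha := hroute hn _ (toE2_Ypt_mem_Ycluster i a)
  have hb := hroute hn' _ (toE2_Ypt_mem_Ycluster i' b)
  constructor
  · intro e
    obtain rfl : n = n' := by rw [← ha, ← hb, e]
    by_contra hne
    have hle : Ycluster i + Ycluster i' ≤ Yset k := by
      have hpair := Finset.sum_pair (f := fun i => Ycluster (i + 1))
        (show i - 1 ≠ i' - 1 by omega)
      simp only [Nat.sub_add_cancel hi, Nat.sub_add_cancel hi'] at hpair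
      rw [← hpair]
      refine Finset.sum_le_sum_of_subset (t := Finset.range k) ?_
      intro m hm
      simp only [Finset.mem_insert, Finset.mem_singleton] at hm
      exact Finset.mem_range.2 (by omega)
    have hcard := Multiset.card_le_card
      (Multiset.filter_le_filter (fun x => t.route x = n) hle)
    rw [Multiset.filter_add, Multiset.filter_eq_self.2 (hroute hn),
      Multiset.filter_eq_self.2 (hroute hn'), ← hn, Multiset.card_add, card_Ycluster,
      card_Ycluster] at hcard
    omega
  · rintro rfl
    obtain rfl : n = n' := ha.symm.trans (hroute hn' _ (toE2_Ypt_mem_Ycluster i a))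
    rw [ha, hb]

/-- STATEMENT: every threshold decision tree with `k` leaves and depth at most `k - 2`
induces on `Y_k` a clustering different from the partition `C = (C_1, …, C_k)`. -/
theorem stmt_16 (k : ℕ) (hk : 3 ≤ k) :
    ∀ t : TDT 2, t.leaves = k → t.depth ≤ k - 2 →
      t.clustering (Yset k) ≠ Ypartition k := by
  intro t _ hdepth h
  have := (TDT.separates_of_clustering_eq h).le_depth_add_one
  omega

end
end
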